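/- Cancellation Lemma: let h ∈ G fix every binary word of length 3, and for each of the eight binary words v of length 3 define the section h_v ∈ Aut(T) by h(v ++ w) = v ++ h_v(w) for all words w. Then each h_v belongs to G, and the sum over all eight words v of length 3 of ℓ(h_v) is at most (5/6)·ℓ(h) + 8. -/

import Mathlib

namespace Grig

def aFun : List Bool → List Bool
  | [] => []
  | x :: v => (!x) :: v

mutual
  def bFun : List Bool → List Bool
    | [] => []
    | false :: v => false :: aFun v
    | true :: v => true :: cFun v
  def cFun : List Bool → List Bool
    | [] => []
    | false :: v => false :: aFun v
    | true :: v => true :: dFun v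
  def dFun : List Bool → List Bool
    | [] => []
    | false :: v => false :: v
    | true :: v => true :: bFun v
end

theorem aFun_invol : Function.Involutive aFun := by
  intro v; cases v <;> simp [aFun]

theorem bcd_invol : ∀ v, bFun (bFun v) = v ∧ cFun (cFun v) = v ∧ dFun (dFun v) = v := by
  intro v
  induction v with
  | nil => simp [bFun, cFun, dFun]
  | cons x v ih =>
    cases x <;> simp [bFun, cFun, dFun, aFun_invol v, ih.1, ih.2.1, ih.2.2]

/-- The automorphism `a` of the binary tree. -/
def a : Equiv.Perm (List Bool) := Function.Involutive.toPerm aFun aFun_invol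

def b : Equiv.Perm (List Bool) := Function.Involutive.toPerm bFun (fun v => (bcd_invol v).1)

def c : Equiv.Perm (List Bool) := Function.Involutive.toPerm cFun (fun v => (bcd_invol v).2.1)

def d : Equiv.Perm (List Bool) := Function.Involutive.toPerm dFun (fun v => (bcd_invol v).2.2)

/-- The Grigorchuk group, as the subgroup generated by `a, b, c, d` inside the
permutation group of the vertex set of the binary tree. -/
def grigG : Subgroup (Equiv.Perm (List Bool)) := Subgroup.closure {a, b, c, d}

end Grig

namespace Grig

/-- The word length of `g`: the least `n` such that `g` is a product of `n` elements of
`{a, b, c, d}`. -/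
noncomputable def wlen (g : Equiv.Perm (List Bool)) : ℕ :=
  sInf {n : ℕ | ∃ l : List (Equiv.Perm (List Bool)), l.length = n ∧
    (∀ x ∈ l, x ∈ ({a, b, c, d} : Set (Equiv.Perm (List Bool)))) ∧ l.prod = g}

end Grig

namespace Grig

/-- Letters. -/
inductive Ltr | A | B | C | D
  deriving DecidableEq

open Ltr

def evL : Ltr → Equiv.Perm (List Bool)
  | A => a
  | B => b
  | C => c
  | D => d

def ev (w : List Ltr) : Equiv.Perm (List Bool) := (w.map evL).prod

theorem ev_nil : ev [] = 1 := rfl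

theorem ev_cons (x : Ltr) (w : List Ltr) : ev (x :: w) = evL x * ev w := by simp [ev]

theorem ev_append (u w : List Ltr) : ev (u ++ w) = ev u * ev w := by simp [ev]

theorem evL_sq (x : Ltr) : evL x * evL x = 1 := by
  ext1 v
  cases x
  · exact aFun_invol v
  · exact (bcd_invol v).1
  · exact (bcd_invol v).2.1
  · exact (bcd_invol v).2.2

theorem bcd_rel : ∀ v, bFun (cFun v) = dFun v ∧ cFun (bFun v) = dFun v ∧
    bFun (dFun v) = cFun v ∧ dFun (bFun v) = cFun v ∧
    cFun (dFun v) = bFun v ∧ dFun (cFun v) = bFun v := by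
  intro v
  induction v with
  | nil => simp [bFun, cFun, dFun]
  | cons x v ih =>
    obtain ⟨h1, h2, h3, h4, h5, h6⟩ := ih
    cases x <;> simp [bFun, cFun, dFun, aFun_invol v, h1, h2, h3, h4, h5, h6]

theorem bc_eq : b * c = d := by ext1 v; exact (bcd_rel v).1
theorem cb_eq : c * b = d := by ext1 v; exact (bcd_rel v).2.1
theorem bd_eq : b * d = c := by ext1 v; exact (bcd_rel v).2.2.1
theorem db_eq : d * b = c := by ext1 v; exact (bcd_rel v).2.2.2.1
theorem cd_eq : c * d = b := by ext1 v; exact (bcd_rel v).2.2.2.2.1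
theorem dc_eq : d * c = b := by ext1 v; exact (bcd_rel v).2.2.2.2.2

/-- Product of two letters, as a word of length at most two. -/
def mulL : Ltr → Ltr → List Ltr
  | A, A => []
  | B, B => []
  | C, C => []
  | D, D => []
  | B, C => [D]
  | C, B => [D]
  | B, D => [C]
  | D, B => [C]
  | C, D => [B]
  | D, C => [B]
  | x, y => [x, y]

theorem ev_mulL (x y : Ltr) : ev (mulL x y) = evL x * evL y := by
  cases x <;> cases y <;>
    simp only [mulL, ev_nil, ev_cons, mul_one, evL_sq] <;>
    simp [evL, bc_eq, cb_eq, bd_eq, db_eq, cd_eq, dc_eq]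

def rcons (x : Ltr) : List Ltr → List Ltr
  | [] => [x]
  | y :: v => mulL x y ++ v

def red : List Ltr → List Ltr
  | [] => []
  | x :: w => rcons x (red w)

theorem ev_rcons (x : Ltr) (w : List Ltr) : ev (rcons x w) = evL x * ev w := by
  cases w with
  | nil => simp [rcons, ev_cons, ev_nil]
  | cons y v => simp [rcons, ev_append, ev_mulL, ev_cons, mul_assoc]

theorem ev_red (w : List Ltr) : ev (red w) = ev w := by
  induction w with
  | nil => rfl
  | cons x w ih => rw [red, ev_rcons, ih, ev_cons]

/-- Exactly one of the two adjacent letters is `A`. -/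
def Alt (x y : Ltr) : Prop := x = A ↔ y ≠ A

def Red : List Ltr → Prop
  | [] => True
  | [_] => True
  | x :: y :: v => Alt x y ∧ Red (y :: v)

theorem Red_rcons (x : Ltr) (w : List Ltr) (h : Red w) : Red (rcons x w) := by
  rcases w with _ | ⟨y, _ | ⟨z, v⟩⟩
  · trivial
  · cases x <;> cases y <;> simp [rcons, mulL, Red, Alt]
  · revert h
    cases x <;> cases y <;> cases z <;> simp [rcons, mulL, Red, Alt]

theorem Red_red (w : List Ltr) : Red (red w) := by
  induction w with
  | nil => trivial
  | cons x w ih => exact Red_rcons x _ ih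

theorem length_rcons (x : Ltr) (w : List Ltr) : (rcons x w).length ≤ w.length + 1 := by
  rcases w with _ | ⟨y, v⟩
  · simp [rcons]
  · cases x <;> cases y <;> simp [rcons, mulL] <;> omega

theorem count_rcons (l : Ltr) (x : Ltr) (w : List Ltr) :
    (rcons x w).length + (x :: w).count l ≤ w.length + 1 + (rcons x w).count l := by
  rcases w with _ | ⟨y, v⟩
  · simp [rcons]
  · cases l <;> cases x <;> cases y <;> simp [rcons, mulL] <;> omega

theorem length_red (w : List Ltr) : (red w).length ≤ w.length := by
  induction w with
  | nil => simp [red]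
  | cons x w ih => have := length_rcons x (red w); simp only [red, List.length_cons]; omega

theorem count_red (l : Ltr) (w : List Ltr) :
    (red w).length + w.count l ≤ w.length + (red w).count l := by
  induction w with
  | nil => simp [red]
  | cons x w ih =>
    have := count_rcons l x (red w)
    simp only [red, List.length_cons, List.count_cons] at *
    omega

theorem length_eq (w : List Ltr) :
    w.length = w.count A + w.count B + w.count C + w.count D := by
  induction w with
  | nil => simp
  | cons x w ih => cases x <;> simp <;> omega

theorem Red_count : ∀ w : List Ltr, Red w →
    w.length ≤ 2 * w.count A + 1 ∧ 2 * w.count A ≤ w.length + 1 ∧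
    (w.head? = some A → w.length ≤ 2 * w.count A) ∧
    (w.head? ≠ some A → 2 * w.count A ≤ w.length)
  | [], _ => by simp
  | [x], _ => by cases x <;> simp
  | x :: y :: v, h => by
    have ih := Red_count (y :: v) h.2
    have h1 := h.1
    revert ih h1
    cases x <;> cases y <;> simp [Alt] <;> omega

/-- Action on the first letter. -/
def out (w : List Ltr) (x : Bool) : Bool :=
  match w with
  | [] => x
  | A :: w => !(out w x)
  | _ :: w => out w x

def secL : Ltr → Bool → List Ltr
  | A, _ => []
  | B, false => [A]
  | B, true => [C]
  | C, false => [A]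
  | C, true => [D]
  | D, false => []
  | D, true => [B]

def sct (w : List Ltr) (x : Bool) : List Ltr :=
  match w with
  | [] => []
  | l :: w => secL l (out w x) ++ sct w x

theorem ev_sct (w : List Ltr) (x : Bool) (v : List Bool) :
    ev w (x :: v) = out w x :: ev (sct w x) v := by
  induction w with
  | nil => rfl
  | cons l w ih =>
    rw [ev_cons, Equiv.Perm.mul_apply, ih, sct, ev_append, Equiv.Perm.mul_apply]
    cases l
    · rfl
    all_goals
      simp only [out]
      cases out w x
      · rfl
      · rfl

theorem out_not (w : List Ltr) : out w true = !(out w false) := by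
  induction w with
  | nil => rfl
  | cons l w ih => cases l <;> simp [out, ih]

theorem count_sct (w : List Ltr) :
    (sct w false).count A + (sct w true).count A = w.count B + w.count C ∧
    (sct w false).count B + (sct w true).count B = w.count D ∧
    (sct w false).count C + (sct w true).count C = w.count B ∧
    (sct w false).count D + (sct w true).count D = w.count C := by
  induction w with
  | nil => simp [sct]
  | cons l w ih =>
    simp only [sct, out_not]
    cases l <;> cases out w false <;> simp [secL] <;> omega

theorem sct_bound (w : List Ltr) (h : Red w) :
    (sct w false).length + (sct w true).length + w.count D ≤ w.length + 1 := by
  have h1 := count_sct w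
  have h2 := Red_count w h
  have h3 := length_eq w
  have h4 := length_eq (sct w false)
  have h5 := length_eq (sct w true)
  omega

/-- One reduced step. -/
def stp (w : List Ltr) (x : Bool) : List Ltr := red (sct w x)

theorem ev_stp (w : List Ltr) (x : Bool) (v : List Bool) :
    ev w (x :: v) = out w x :: ev (stp w x) v := by
  rw [ev_sct, stp, ev_red]

theorem stp_bound (w : List Ltr) (h : Red w) :
    (stp w false).length + (stp w true).length + w.count D ≤ w.length + 1 ∧
    (stp w false).length + (stp w true).length + w.count D + w.count B ≤
      w.length + 1 + (stp w false).count C + (stp w true).count C ∧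
    (stp w false).length + (stp w true).length + w.count D + w.count C ≤
      w.length + 1 + (stp w false).count D + (stp w true).count D := by
  have h1 := count_sct w
  have h2 := sct_bound w h
  have h3 := length_red (sct w false)
  have h4 := length_red (sct w true)
  have h5 := count_red C (sct w false)
  have h6 := count_red C (sct w true)
  have h7 := count_red D (sct w false)
  have h8 := count_red D (sct w true)
  simp only [stp]
  omega

def stp3 (w : List Ltr) (x y z : Bool) : List Ltr := stp (stp (stp w x) y) z

theorem total_bound (w : List Ltr) (h : Red w) :
    6 * ((stp3 w false false false).length + (stp3 w false false true).length +
      (stp3 w false true false).length + (stp3 w false true true).length +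
      (stp3 w true false false).length + (stp3 w true false true).length +
      (stp3 w true true false).length + (stp3 w true true true).length)
      ≤ 5 * w.length + 48 := by
  have r : ∀ u x, Red (stp u x) := fun u x => Red_red _
  have e := stp_bound w h
  have e0 := stp_bound _ (r w false)
  have e1 := stp_bound _ (r w true)
  have e00 := stp_bound _ (r (stp w false) false)
  have e01 := stp_bound _ (r (stp w false) true)
  have e10 := stp_bound _ (r (stp w true) false)
  have e11 := stp_bound _ (r (stp w true) true)
  have hc := Red_count w h
  have hl := length_eq w
  simp only [stp3]
  obtain ⟨e1', e2', e3'⟩ := e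
  obtain ⟨f1, -, f3⟩ := e0
  obtain ⟨g1, -, g3⟩ := e1
  obtain ⟨a1, -, -⟩ := e00
  obtain ⟨b1, -, -⟩ := e01
  obtain ⟨c1, -, -⟩ := e10
  obtain ⟨d1, -, -⟩ := e11
  obtain ⟨-, k, -, -⟩ := hc
  linarith

theorem ev_mem (w : List Ltr) : ev w ∈ grigG := by
  induction w with
  | nil => exact grigG.one_mem
  | cons x w ih =>
    rw [ev_cons]
    refine grigG.mul_mem (Subgroup.subset_closure ?_) ih
    cases x <;> simp [evL]

theorem evL_mem (x : Ltr) : evL x ∈ ({a, b, c, d} : Set (Equiv.Perm (List Bool))) := by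
  cases x <;> simp [evL]

theorem exists_evL (g : Equiv.Perm (List Bool))
    (hg : g ∈ ({a, b, c, d} : Set (Equiv.Perm (List Bool)))) : ∃ x, evL x = g := by
  rcases hg with h | h | h | h
  exacts [⟨A, h.symm⟩, ⟨B, h.symm⟩, ⟨C, h.symm⟩, ⟨D, h.symm⟩]

theorem wlen_ev_le (w : List Ltr) : wlen (ev w) ≤ w.length := by
  refine Nat.sInf_le ⟨w.map evL, by simp, ?_, rfl⟩
  intro x hx
  obtain ⟨y, -, rfl⟩ := List.mem_map.1 hx
  exact evL_mem y

theorem ev_inv (w : List Ltr) : ev w.reverse = (ev w)⁻¹ := by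
  induction w with
  | nil => simp [ev_nil]
  | cons x w ih =>
    have : (evL x)⁻¹ = evL x := inv_eq_of_mul_eq_one_left (evL_sq x)
    simp [ev_append, ih, ev_cons, ev_nil, this]

theorem exists_ev (g : Equiv.Perm (List Bool)) (hg : g ∈ grigG) : ∃ w, ev w = g := by
  induction hg using Subgroup.closure_induction with
  | mem x hx =>
    obtain ⟨y, rfl⟩ := exists_evL x hx
    exact ⟨[y], by simp [ev_cons, ev_nil]⟩
  | one => exact ⟨[], rfl⟩
  | mul x y _ _ hx hy =>
    obtain ⟨u, rfl⟩ := hx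
    obtain ⟨v, rfl⟩ := hy
    exact ⟨u ++ v, ev_append u v⟩
  | inv x _ hx =>
    obtain ⟨u, rfl⟩ := hx
    exact ⟨u.reverse, ev_inv u⟩

theorem word_of_list (l : List (Equiv.Perm (List Bool)))
    (hl : ∀ x ∈ l, x ∈ ({a, b, c, d} : Set (Equiv.Perm (List Bool)))) :
    ∃ w : List Ltr, w.length = l.length ∧ ev w = l.prod := by
  induction l with
  | nil => exact ⟨[], rfl, rfl⟩
  | cons x l ih =>
    obtain ⟨w, h1, h2⟩ := ih (fun y hy => hl y (List.mem_cons_of_mem _ hy))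
    obtain ⟨y, rfl⟩ := exists_evL x (hl x List.mem_cons_self)
    exact ⟨y :: w, by simp [h1], by rw [ev_cons, h2, List.prod_cons]⟩

theorem exists_red (g : Equiv.Perm (List Bool)) (hg : g ∈ grigG) :
    ∃ w, Red w ∧ ev w = g ∧ w.length ≤ wlen g := by
  obtain ⟨u, rfl⟩ := exists_ev g hg
  have hne : {n : ℕ | ∃ l : List (Equiv.Perm (List Bool)), l.length = n ∧
    (∀ x ∈ l, x ∈ ({a, b, c, d} : Set (Equiv.Perm (List Bool)))) ∧ l.prod = ev u}.Nonempty := by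
    refine ⟨_, u.map evL, rfl, ?_, rfl⟩
    intro x hx
    obtain ⟨y, -, rfl⟩ := List.mem_map.1 hx
    exact evL_mem y
  obtain ⟨l, h1, h2, h3⟩ := Nat.sInf_mem hne
  obtain ⟨w, h4, h5⟩ := word_of_list l h2
  refine ⟨red w, Red_red w, by rw [ev_red, h5, h3], (length_red w).trans ?_⟩
  rw [h4, h1]; rfl

/-- **Cancellation Lemma.** Let `h ∈ G` fix every binary word of length `3`, and for each
of the eight binary words `v` of length `3` (encoded as `t : Fin 3 → Bool`,
`v = List.ofFn t`) let `sec t` be the section of `h` at `v`, characterized by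
`h (v ++ w) = v ++ sec t w`. Then each section belongs to `G`, and the sum of their word
lengths is at most `(5/6) ℓ(h) + 8`. -/
theorem cancellation_lemma (h : Equiv.Perm (List Bool)) (hh : h ∈ grigG)
    (hfix : ∀ v : List Bool, v.length = 3 → h v = v)
    (sec : (Fin 3 → Bool) → Equiv.Perm (List Bool))
    (hsec : ∀ (t : Fin 3 → Bool) (w : List Bool),
      h (List.ofFn t ++ w) = List.ofFn t ++ sec t w) :
    (∀ t, sec t ∈ grigG) ∧
    (∑ t : Fin 3 → Bool, (wlen (sec t) : ℝ)) ≤ (5 / 6) * (wlen h : ℝ) + 8 := by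
  obtain ⟨w, hw, rfl, hlen⟩ := exists_red h hh
  have key : ∀ t, sec t = ev (stp3 w (t 0) (t 1) (t 2)) := by
    intro t
    ext1 v
    have := hsec t v
    simp only [List.ofFn_succ, List.ofFn_zero, List.cons_append, List.nil_append, ev_stp,
      List.cons.injEq] at this
    exact this.2.2.2.symm
  refine ⟨fun t => key t ▸ ev_mem _, ?_⟩
  have hle : ∀ t, wlen (sec t) ≤ (stp3 w (t 0) (t 1) (t 2)).length := by
    intro t
    rw [key t]
    exact wlen_ev_le _
  have hu : (Finset.univ : Finset (Fin 3 → Bool)) =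
      {![false, false, false], ![false, false, true], ![false, true, false],
       ![false, true, true], ![true, false, false], ![true, false, true],
       ![true, true, false], ![true, true, true]} := by decide
  have hs : ∑ t : Fin 3 → Bool, wlen (sec t) ≤
      (stp3 w false false false).length + (stp3 w false false true).length +
      (stp3 w false true false).length + (stp3 w false true true).length +
      (stp3 w true false false).length + (stp3 w true false true).length +
      (stp3 w true true false).length + (stp3 w true true true).length := by
    refine (Finset.sum_le_sum fun t _ => hle t).trans (le_of_eq ?_)
    rw [hu]
    repeat rw [Finset.sum_insert (by decide)]
    rw [Finset.sum_singleton]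
    simp only [Matrix.cons_val]
    ring
  have ht := total_bound w hw
  have hfin : 6 * ∑ t : Fin 3 → Bool, wlen (sec t) ≤ 5 * wlen (ev w) + 48 := by omega
  have hr : (6 : ℝ) * ∑ t : Fin 3 → Bool, (wlen (sec t) : ℝ) ≤ 5 * (wlen (ev w) : ℝ) + 48 := by
    exact_mod_cast hfin
  linarith

end Grig
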